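/- Suppose char(k) = 0. Let A = R/I_{t-1}(A') where A' is a t×t homogeneous matrix over R = k[x_0,...,x_n] and I_{t-1}(A') has codimension 4. Then A is a Gorenstein ring; equivalently, the scheme X = Proj(A) ⊂ P^n is arithmetically Gorenstein. (Gulliksen–Negård.) -/

import Mathlib

open MvPolynomial CategoryTheory

/-- Homogeneity of integer degree `d` (zero if `d < 0`). -/
def IsHomogZ {σ : Type*} {k : Type*} [CommSemiring k]
    (p : MvPolynomial σ k) (d : ℤ) : Prop :=
  if 0 ≤ d then p.IsHomogeneous d.toNat else p = 0

/-- The codimension (height) of an ideal. -/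
noncomputable def idealCodim {R : Type*} [CommRing R] (I : Ideal R) : ℕ∞ :=
  ⨅ (P : PrimeSpectrum R) (_ : P.asIdeal ∈ I.minimalPrimes), Order.height P

/-- A codimension `c` quotient `A = R/I` is (arithmetically) Gorenstein if
`Ext^c_R(A, R) ≅ A` (up to twist) and `Ext^i_R(A, R) = 0` for `i > c`
(the latter is the Cohen–Macaulay condition). -/
noncomputable def IsGorensteinQuotient {R : Type} [CommRing R]
    (I : Ideal R) (c : ℕ) : Prop :=
  Nonempty
    ((((Ext R (ModuleCat R) c).obj (Opposite.op (ModuleCat.of R (R ⧸ I)))).obj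
        (ModuleCat.of R R)) ≅ ModuleCat.of R (R ⧸ I)) ∧
  ∀ i : ℕ, c < i →
    Limits.IsZero
      (((Ext R (ModuleCat R) i).obj (Opposite.op (ModuleCat.of R (R ⧸ I)))).obj
        (ModuleCat.of R R))

section
open RingTheory.Sequence Pointwise

/-- An acyclicity lemma: a bounded complex whose terms all have `rs` as a weakly regular sequence,
where `rs` is at least as long as the complex, is exact in positive degrees as soon as every member
of `rs` acts nilpotently on the classes in positive degrees. -/
theorem acyclic_of_isWeaklyRegular {R : Type*} [CommRing R] (rs : List R) :
    ∀ (M : ℕ → Type*) [∀ i, AddCommGroup (M i)] [∀ i, Module R (M i)]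
      (d : ∀ i, M (i + 1) →ₗ[R] M i) (_ : ∀ i x, d i (d (i + 1) x) = 0)
      (_ : ∀ i, rs.length < i → Subsingleton (M i))
      (_ : ∀ i, IsWeaklyRegular (M i) rs)
      (_ : ∀ r ∈ rs, ∀ i m, d i m = 0 → ∃ N : ℕ, r ^ N • m ∈ LinearMap.range (d (i + 1)))
      (i : ℕ) (m : M (i + 1)), d i m = 0 → m ∈ LinearMap.range (d (i + 1)) := by
  induction rs with
  | nil =>
    intro M _ _ d _ hM _ _ i m _
    have := hM (i + 1) (by simp)
    exact ⟨0, Subsingleton.elim _ _⟩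
  | cons r rs ih =>
    intro M _ _ d hdd hM hreg htors
    have hr i : IsSMulRegular (M i) r := ((isWeaklyRegular_cons_iff _ _ _).1 (hreg i)).1
    let d' i : QuotSMulTop r (M (i + 1 + 1)) →ₗ[R] QuotSMulTop r (M (i + 1)) :=
      QuotSMulTop.map r (d (i + 1))
    have hd' i x : d' i (Submodule.Quotient.mk x) = Submodule.Quotient.mk (d (i + 1) x) := rfl
    have mk0 i (x : M i) : (Submodule.Quotient.mk x : QuotSMulTop r (M i)) = 0 ↔
        ∃ y, r • y = x := by
      rw [Submodule.Quotient.mk_eq_zero, Submodule.mem_smul_pointwise_iff_exists]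
      simp
    have key := ih (fun i => QuotSMulTop r (M (i + 1))) d'
      (fun i x => by
        obtain ⟨x, rfl⟩ := Submodule.Quotient.mk_surjective _ x
        rw [hd', hd', hdd, Submodule.Quotient.mk_zero])
      (fun i hi => by
        have := hM (i + 1) (by simpa using hi)
        exact (Submodule.Quotient.mk_surjective _).subsingleton)
      (fun i => ((isWeaklyRegular_cons_iff _ _ _).1 (hreg (i + 1))).2)
      (fun s hs i w hw => by
        obtain ⟨w, rfl⟩ := Submodule.Quotient.mk_surjective _ w
        rw [hd', mk0] at hw
        obtain ⟨m, hm⟩ := hw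
        have hm0 : d i m = 0 := by
          apply (hr i).right_eq_zero_of_smul
          rw [← map_smul, hm, hdd]
        obtain ⟨N, u, hu⟩ := htors s (by simp [hs]) i m hm0
        obtain ⟨N', v, hv⟩ := htors s (by simp [hs]) (i + 1) (s ^ N • w - r • u) (by
          rw [map_sub, map_smul, map_smul, hu, ← hm, smul_comm, sub_self])
        refine ⟨N' + N, Submodule.Quotient.mk v, ?_⟩
        rw [hd', hv, ← Submodule.Quotient.mk_smul, ← sub_eq_zero, ← Submodule.Quotient.mk_sub, mk0]
        exact ⟨- s ^ N' • u, by module⟩)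
    have hinj : ∀ i m, d i m = 0 → r • m ∈ LinearMap.range (d (i + 1)) →
        m ∈ LinearMap.range (d (i + 1)) := by
      rintro i m hm ⟨w, hw⟩
      obtain ⟨v, hv⟩ := key i (Submodule.Quotient.mk w) (by rw [hd', mk0]; exact ⟨m, hw.symm⟩)
      obtain ⟨v, rfl⟩ := Submodule.Quotient.mk_surjective _ v
      rw [hd', ← sub_eq_zero, ← Submodule.Quotient.mk_sub, mk0] at hv
      obtain ⟨u, hu⟩ := hv
      refine ⟨-u, hr _ ?_⟩
      simp only
      rw [← map_smul, smul_neg, hu, ← hw, neg_sub, map_sub, hdd, sub_zero]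
    intro i m hm
    obtain ⟨N, hN⟩ := htors r (by simp) i m hm
    induction N with
    | zero => simpa using hN
    | succ N hN' =>
      refine hN' (hinj i _ (by simp [hm]) ?_)
      rwa [smul_smul, ← pow_succ']

end

section
open RingTheory.Sequence Pointwise
open scoped Polynomial

theorem Ideal.height_le_height_comap_of_isIntegral {S B : Type*} [CommRing S] [CommRing B]
    [Algebra S B] [Algebra.IsIntegral S B] (P : Ideal B) [P.IsPrime] :
    P.height ≤ (P.comap (algebraMap S B)).height := by
  have := Order.height_le_height_apply_of_strictMono (PrimeSpectrum.comap (algebraMap S B))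
    (fun p q hpq => Ideal.IsIntegral.comap_lt_comap hpq) ⟨P, inferInstance⟩
  rwa [← PrimeSpectrum.height_eq_orderHeight, ← PrimeSpectrum.height_eq_orderHeight] at this

/-- Every proper ideal contains a weakly regular sequence of any length up to its height. -/
def HasRegularSequences (R : Type*) [CommRing R] : Prop :=
  ∀ (I : Ideal R) (c : ℕ), I ≠ ⊤ → (c : ℕ∞) ≤ I.height →
    ∃ rs : List R, rs.length = c ∧ (∀ r ∈ rs, r ∈ I) ∧ IsWeaklyRegular R rs

theorem exists_isWeaklyRegular_of_monic_mem {S : Type*} [CommRing S] [IsNoetherianRing S]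
    (hS : HasRegularSequences S) {f : S[X]} (hf : f.Monic) {I : Ideal S[X]} (hfI : f ∈ I)
    (hI : I ≠ ⊤) {c : ℕ} (hc : ((c + 1 : ℕ) : ℕ∞) ≤ I.height) :
    ∃ rs : List S[X], rs.length = c + 1 ∧ (∀ r ∈ rs, r ∈ I) ∧ IsWeaklyRegular S[X] rs := by
  let J : Ideal S := I.comap Polynomial.C
  have hJ : J ≠ ⊤ := Ideal.comap_ne_top _ hI
  have hint : Algebra.IsIntegral S (S[X] ⧸ Ideal.span {f}) :=
    ⟨fun x => hf.quotient_isIntegral (Ideal.mem_span_singleton_self f) x⟩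
  have hle : Ideal.span {f} ≤ I := (Ideal.span_singleton_le_iff_mem I).2 hfI
  have hJc : (c : ℕ∞) ≤ J.height := by
    rw [Ideal.height_eq_inf_minimalPrimes]
    refine le_iInf₂ fun Q hQ => ?_
    have : Q.IsPrime := hQ.1.1
    obtain ⟨P, hIP, hP, hPQ⟩ := Ideal.exists_ideal_over_prime_of_isIntegral Q
      (I.map (Ideal.Quotient.mk (Ideal.span {f}))) (by
        intro x hx
        refine hQ.1.2 (x := x) ?_
        have hx : Ideal.Quotient.mk (Ideal.span {f}) (Polynomial.C x) ∈ I.map _ := hx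
        rwa [Ideal.mem_quotient_iff_mem hle] at hx)
    let P' := P.comap (Ideal.Quotient.mk (Ideal.span {f}))
    have hP' : I ≤ P' := Ideal.map_le_iff_le_comap.1 hIP
    have h1 := Ideal.height_le_height_add_one_of_mem (hP' hfI)
    rw [Ideal.map_comap_of_surjective _ Ideal.Quotient.mk_surjective] at h1
    have h2 := P.height_le_height_comap_of_isIntegral (S := S)
    rw [hPQ] at h2
    have h3 := hc.trans ((Ideal.height_mono hP').trans (h1.trans (add_le_add_left h2 1)))
    push_cast at h3
    exact (ENat.add_le_add_iff_right ENat.one_ne_top).1 h3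
  obtain ⟨rs, hlen, hmem, hreg⟩ := hS J c hJ hJc
  refine ⟨f :: rs.map Polynomial.C, by simp [hlen], ?_, ?_⟩
  · simp only [List.mem_cons, List.mem_map, forall_eq_or_imp, hfI, true_and]
    rintro _ ⟨a, ha, rfl⟩
    exact hmem a ha
  · rw [isWeaklyRegular_cons_iff]
    refine ⟨fun a b h => hf.isRegular.left h, ?_⟩
    have : Module.Free S (S[X] ⧸ Ideal.span {f}) := hf.free_quotient
    have h1 := (isWeaklyRegular_map_algebraMap_iff S[X] (S[X] ⧸ Ideal.span {f}) rs).2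
      ((isWeaklyRegular_map_algebraMap_iff (S[X] ⧸ Ideal.span {f})
        (S[X] ⧸ Ideal.span {f}) rs).1 hreg.of_flat)
    refine (LinearEquiv.isWeaklyRegular_congr (Submodule.quotEquivOfEq _ _ ?_) _).1 h1
    ext x
    simp [Ideal.mem_span_singleton', Submodule.mem_smul_pointwise_iff_exists, mul_comm]

theorem HasRegularSequences.of_ringEquiv {R S : Type*} [CommRing R] [CommRing S] (e : R ≃+* S)
    {I : Ideal R} {c : ℕ}
    (h : ∃ rs : List S, rs.length = c ∧ (∀ r ∈ rs, r ∈ I.map e) ∧ IsWeaklyRegular S rs) :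
    ∃ rs : List R, rs.length = c ∧ (∀ r ∈ rs, r ∈ I) ∧ IsWeaklyRegular R rs := by
  obtain ⟨rs, hlen, hmem, hreg⟩ := h
  refine ⟨rs.map e.symm, by simpa using hlen, ?_, ?_⟩
  · simp only [List.mem_map]
    rintro _ ⟨a, ha, rfl⟩
    have := hmem a ha
    rw [← Ideal.comap_symm] at this
    exact this
  · refine (e.symm.toAddEquiv.isWeaklyRegular_congr ?_).1 hreg
    refine List.forall₂_map_right_iff.2 (List.forall₂_same.2 fun r _ x => ?_)
    simp

end

section
open MvPolynomial

variable {k : Type*} [Field k] {n : ℕ}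

/-- The substitution `X₀ ↦ X₀`, `Xᵢ ↦ Xᵢ + c X₀ ^ (N ^ i)` of Nagata. -/
noncomputable def nagataHom (n N : ℕ) (c : k) :
    MvPolynomial (Fin (n + 1)) k →ₐ[k] MvPolynomial (Fin (n + 1)) k :=
  aeval fun i ↦ if i = 0 then X 0 else X i + c • X 0 ^ (N ^ i.1)

theorem nagataHom_comp_neg (N : ℕ) (c : k) :
    (nagataHom n N c).comp (nagataHom n N (-c)) = AlgHom.id _ _ := by
  rw [nagataHom, nagataHom, comp_aeval, ← MvPolynomial.aeval_X_left]
  ext i v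
  cases i using Fin.cases <;> simp

/-- The Nagata substitution followed by the isomorphism singling out the variable `X₀`. -/
noncomputable def nagataEquiv (k : Type*) [Field k] (n N : ℕ) :
    MvPolynomial (Fin (n + 1)) k ≃ₐ[k] Polynomial (MvPolynomial (Fin n) k) :=
  (AlgEquiv.ofAlgHom (nagataHom n N 1) (nagataHom n N (-1)) (nagataHom_comp_neg N 1)
    (by simpa using nagataHom_comp_neg N (-1 : k))).trans (finSuccEquiv k n)

theorem nagataEquiv_X (N : ℕ) (i : Fin (n + 1)) :
    nagataEquiv k n N (X i) = if i = 0 then Polynomial.X else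
      finSuccEquiv k n (X i) + Polynomial.X ^ (N ^ i.1) := by
  cases i using Fin.cases <;> simp [nagataEquiv, nagataHom, finSuccEquiv_X_zero]

theorem monic_nagataEquiv_X {N : ℕ} (hN : 0 < N) (i : Fin (n + 1)) :
    (nagataEquiv k n N (X i)).Monic ∧ (nagataEquiv k n N (X i)).natDegree = N ^ i.1 := by
  rw [nagataEquiv_X]
  cases i using Fin.cases with
  | zero => simp [Polynomial.monic_X]
  | succ i =>
    have : 0 < N ^ (i.1 + 1) := by positivity
    simp only [Fin.succ_ne_zero, if_false, finSuccEquiv_X_succ, add_comm (Polynomial.C _)]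
    exact ⟨Polynomial.monic_X_pow_add_C _ this.ne', Polynomial.natDegree_X_pow_add_C⟩

theorem nagataEquiv_monomial {N : ℕ} (hN : 0 < N) (v : Fin (n + 1) →₀ ℕ) (a : k) :
    ∃ q : Polynomial (MvPolynomial (Fin n) k), q.Monic ∧
      q.natDegree = ∑ i : Fin (n + 1), N ^ i.1 * v i ∧
      nagataEquiv k n N (monomial v a) = Polynomial.C (C a) * q := by
  refine ⟨∏ i, nagataEquiv k n N (X i) ^ v i, ?_, ?_, ?_⟩
  · exact Polynomial.monic_prod_of_monic _ _ fun i _ => (monic_nagataEquiv_X hN i).1.pow _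
  · rw [Polynomial.natDegree_prod_of_monic _ _ fun i _ => (monic_nagataEquiv_X hN i).1.pow _]
    refine Finset.sum_congr rfl fun i _ => ?_
    rw [(monic_nagataEquiv_X hN i).1.natDegree_pow, (monic_nagataEquiv_X hN i).2, mul_comm]
  · rw [monomial_eq, map_mul, Finsupp.prod_fintype _ _ (by simp), map_prod]
    simp only [map_pow]
    congr 1
    rw [← algebraMap_eq, AlgEquiv.commutes]
    rfl

theorem sum_pow_mul_injOn (N : ℕ) (hN : 1 < N) :
    Set.InjOn (fun v : Fin (n + 1) →₀ ℕ => ∑ i : Fin (n + 1), N ^ i.1 * v i)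
      {v | ∀ i, v i < N} := by
  intro v hv w hw h
  refine Finsupp.ext <| congrFun <| List.ofFn_inj.mp ?_
  apply Nat.ofDigits_inj_of_len_eq hN (by simp) (List.forall_mem_ofFn_iff.2 hv)
    (List.forall_mem_ofFn_iff.2 hw)
  simpa only [Nat.ofDigits_eq_sum_mapIdx, List.mapIdx_eq_ofFn, List.get_ofFn, List.length_ofFn,
    Fin.val_cast, mul_comm, List.sum_ofFn] using! h

theorem exists_ringEquiv_isUnit_leadingCoeff {f : MvPolynomial (Fin (n + 1)) k} (hf : f ≠ 0) :
    ∃ e : MvPolynomial (Fin (n + 1)) k ≃+* Polynomial (MvPolynomial (Fin n) k),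
      IsUnit (e f).leadingCoeff := by
  let N := 2 + f.totalDegree
  have hN : 1 < N := by lia
  choose q hq hdeg heq using fun v =>
    nagataEquiv_monomial (k := k) (n := n) (zero_lt_one.trans hN) v
  let D (v : Fin (n + 1) →₀ ℕ) := ∑ i : Fin (n + 1), N ^ i.1 * v i
  obtain ⟨v, hv, hmax⟩ := Finset.exists_max_image f.support D (support_nonempty.mpr hf)
  have hlt : ∀ w ∈ f.support, w ≠ v → D w < D v := by
    intro w hw hwv
    refine lt_of_le_of_ne (hmax w hw) fun h => hwv (sum_pow_mul_injOn N hN ?_ ?_ h)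
    all_goals
      intro i
      exact lt_of_le_of_lt ((monomial_le_degreeOf i ‹_›).trans (degreeOf_le_totalDegree f i))
        (by lia)
  refine ⟨(nagataEquiv k n N).toRingEquiv, ?_⟩
  have hsum : nagataEquiv k n N f =
      ∑ w ∈ f.support, Polynomial.C (C (coeff w f)) * q w (coeff w f) := by
    conv_lhs => rw [← f.support_sum_monomial_coeff, map_sum]
    exact Finset.sum_congr rfl fun w _ => heq w _
  have hcoeff : (nagataEquiv k n N f).coeff (D v) = C (coeff v f) := by
    rw [hsum, Polynomial.finsetSum_coeff, Finset.sum_eq_single v]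
    · rw [Polynomial.coeff_C_mul, show D v = _ from (hdeg v (coeff v f)).symm,
        (hq _ _).coeff_natDegree, mul_one]
    · intro w hw hwv
      rw [Polynomial.coeff_C_mul, Polynomial.coeff_eq_zero_of_natDegree_lt, mul_zero]
      rw [hdeg]
      exact hlt w hw hwv
    · exact fun h => absurd hv h
  have hle : (nagataEquiv k n N f).natDegree ≤ D v := by
    rw [hsum]
    refine Polynomial.natDegree_sum_le_of_forall_le _ _ fun w hw => ?_
    refine (Polynomial.natDegree_C_mul_le _ _).trans ?_
    rw [hdeg]
    exact hmax w hw
  have hne : coeff v f ≠ 0 := mem_support_iff.1 hv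
  have hnat : (nagataEquiv k n N f).natDegree = D v := by
    refine le_antisymm hle (Polynomial.le_natDegree_of_ne_zero ?_)
    rw [hcoeff]
    simpa using hne
  change IsUnit (Polynomial.leadingCoeff (nagataEquiv k n N f))
  rw [Polynomial.leadingCoeff, hnat, hcoeff]
  exact hne.isUnit.map C

theorem hasRegularSequences_mvPolynomial (k : Type*) [Field k] (n : ℕ) :
    HasRegularSequences (MvPolynomial (Fin n) k) := by
  induction n with
  | zero =>
    intro I c hI hc
    have hfield := (isEmptyAlgEquiv k (Fin 0)).toMulEquiv.isField (Field.toIsField k)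
    let _ := hfield.toField
    obtain rfl := (Ideal.eq_bot_or_top I).resolve_right hI
    rw [Ideal.height_bot] at hc
    obtain rfl : c = 0 := by simpa using hc
    exact ⟨[], by simp⟩
  | succ n ih =>
    intro I c hI hc
    cases c with
    | zero => exact ⟨[], by simp⟩
    | succ c =>
      have hbot : I ≠ ⊥ := by
        rintro rfl
        rw [Ideal.height_bot] at hc
        simp at hc
      obtain ⟨f, hfI, hf⟩ := Submodule.exists_mem_ne_zero_of_ne_bot hbot
      obtain ⟨e, he⟩ := exists_ringEquiv_isUnit_leadingCoeff hf
      refine HasRegularSequences.of_ringEquiv e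
        (exists_isWeaklyRegular_of_monic_mem ih
          (Polynomial.monic_of_isUnit_leadingCoeff_inv_smul he)
          (Submodule.smul_of_tower_mem _ he.unit⁻¹.val (Ideal.mem_map_of_mem _ hfI)) ?_ ?_)
      · rw [← Ideal.comap_symm]
        exact Ideal.comap_ne_top _ hI
      · exact (e.height_map I).symm ▸ hc

end

section
open Matrix

variable {R : Type*} [CommRing R] {ι : Type*} [Fintype ι] [DecidableEq ι]
  {M N : Type*} [AddCommGroup M] [Module R M] [Module Rᵐᵒᵖ M] [IsCentralScalar R M]
  [AddCommGroup N] [Module R N] [Module Rᵐᵒᵖ N] [IsCentralScalar R N]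

/-- The first order deformation `A + ε X` of a matrix `A`, as a matrix over a square-zero
extension. -/
def Matrix.deform (A : Matrix ι ι R) (X : Matrix ι ι M) : Matrix ι ι (TrivSqZeroExt R M) :=
  Matrix.of fun i j => TrivSqZeroExt.inl (A i j) + TrivSqZeroExt.inr (X i j)

/-- The derivative of the adjugate at `A` in the direction `X`. -/
def Matrix.adjDeriv (A : Matrix ι ι R) (X : Matrix ι ι M) : Matrix ι ι M :=
  (A.deform X).adjugate.map TrivSqZeroExt.snd

/-- The derivative of the determinant at `A` in the direction `X`. -/
def Matrix.detDeriv (A : Matrix ι ι R) (X : Matrix ι ι M) : M :=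
  (A.deform X).det.snd

namespace Matrix

theorem deform_map_fst (A : Matrix ι ι R) (X : Matrix ι ι M) :
    (TrivSqZeroExt.fstHom R R M).mapMatrix (A.deform X) = A := by
  ext i j
  simp [deform]

theorem deform_map_snd (A : Matrix ι ι R) (X : Matrix ι ι M) :
    (A.deform X).map TrivSqZeroExt.snd = X := by
  ext i j
  simp [deform]

theorem adjugate_deform (A : Matrix ι ι R) (X : Matrix ι ι M) :
    (A.deform X).adjugate = A.adjugate.deform (A.adjDeriv X) := by
  have h := (TrivSqZeroExt.fstHom R R M).map_adjugate (A.deform X)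
  rw [deform_map_fst] at h
  ext i j
  · rw [← h]
    simp [deform]
  · simp [deform, adjDeriv]

theorem det_deform (A : Matrix ι ι R) (X : Matrix ι ι M) :
    (A.deform X).det = TrivSqZeroExt.inl A.det + TrivSqZeroExt.inr (A.detDeriv X) := by
  have h := (TrivSqZeroExt.fstHom R R M).map_det (A.deform X)
  rw [deform_map_fst] at h
  ext
  · simpa using h
  · simp [detDeriv]

theorem mapMatrix_deform (f : M →ₗ[R] N) (A : Matrix ι ι R) (X : Matrix ι ι M) :
    (TrivSqZeroExt.map f).mapMatrix (A.deform X) = A.deform (X.map f) := by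
  ext i j <;> simp [deform]

theorem adjDeriv_map (f : M →ₗ[R] N) (A : Matrix ι ι R) (X : Matrix ι ι M) :
    A.adjDeriv (X.map f) = (A.adjDeriv X).map f := by
  rw [adjDeriv, ← mapMatrix_deform, ← AlgHom.map_adjugate]
  ext i j
  simp [adjDeriv]

theorem detDeriv_map (f : M →ₗ[R] N) (A : Matrix ι ι R) (X : Matrix ι ι M) :
    A.detDeriv (X.map f) = f (A.detDeriv X) := by
  rw [detDeriv, ← mapMatrix_deform, ← AlgHom.map_det]
  simp [detDeriv]

theorem adjDeriv_add (A X Y : Matrix ι ι R) :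
    A.adjDeriv (X + Y) = A.adjDeriv X + A.adjDeriv Y := by
  let Z : Matrix ι ι (R × R) := Matrix.of fun i j => (X i j, Y i j)
  have h1 : X = Z.map (LinearMap.fst R R R) := rfl
  have h2 : Y = Z.map (LinearMap.snd R R R) := rfl
  have h3 : X + Y = Z.map (LinearMap.fst R R R + LinearMap.snd R R R) := rfl
  rw [h3, h1, h2, adjDeriv_map, adjDeriv_map, adjDeriv_map]
  rfl

theorem detDeriv_add (A X Y : Matrix ι ι R) :
    A.detDeriv (X + Y) = A.detDeriv X + A.detDeriv Y := by
  let Z : Matrix ι ι (R × R) := Matrix.of fun i j => (X i j, Y i j)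
  have h1 : X = Z.map (LinearMap.fst R R R) := rfl
  have h2 : Y = Z.map (LinearMap.snd R R R) := rfl
  have h3 : X + Y = Z.map (LinearMap.fst R R R + LinearMap.snd R R R) := rfl
  rw [h3, h1, h2, detDeriv_map, detDeriv_map, detDeriv_map]
  rfl

theorem adjDeriv_smul (A X : Matrix ι ι R) (c : R) :
    A.adjDeriv (c • X) = c • A.adjDeriv X := by
  have h : c • X = X.map (LinearMap.lsmul R R c) := rfl
  rw [h, adjDeriv_map]
  rfl

theorem detDeriv_smul (A X : Matrix ι ι R) (c : R) :
    A.detDeriv (c • X) = c • A.detDeriv X := by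
  have h : c • X = X.map (LinearMap.lsmul R R c) := rfl
  rw [h, detDeriv_map]
  rfl

/-- `adjDeriv` as a linear map. -/
def adjDerivₗ (A : Matrix ι ι R) : Matrix ι ι R →ₗ[R] Matrix ι ι R where
  toFun := A.adjDeriv
  map_add' := A.adjDeriv_add
  map_smul' c X := A.adjDeriv_smul X c

/-- `detDeriv` as a linear map. -/
def detDerivₗ (A : Matrix ι ι R) : Matrix ι ι R →ₗ[R] R where
  toFun := A.detDeriv
  map_add' := A.detDeriv_add
  map_smul' c X := A.detDeriv_smul X c

theorem deform_mul_deform (A B X Y : Matrix ι ι R) :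
    A.deform X * B.deform Y = (A * B).deform (A * Y + X * B) := by
  ext i j
  · simp [deform, mul_apply, TrivSqZeroExt.fst_sum]
  · simp [deform, mul_apply, TrivSqZeroExt.snd_sum, Finset.sum_add_distrib, mul_comm]

theorem detDeriv_single (A : Matrix ι ι R) (i j : ι) :
    A.detDeriv (single i j (1 : R)) = A.adjugate j i := by
  have h : A.deform (single i j (1 : R)) =
      updateRow (A.map (TrivSqZeroExt.inlHom R R)) i (A.map (TrivSqZeroExt.inlHom R R) i +
        (TrivSqZeroExt.inr 1 : TrivSqZeroExt R R) • Pi.single j 1) := by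
    ext a b <;> by_cases ha : a = i <;> by_cases hb : b = j <;>
      simp [deform, updateRow_apply, single_apply, eq_comm (a := i) (b := a),
        eq_comm (a := j) (b := b), ha, hb]
  rw [detDeriv, h, det_updateRow_add, updateRow_eq_self, det_updateRow_smul, ← adjugate_apply]
  have h1 := (TrivSqZeroExt.inlHom R R).map_adjugate A
  have h2 := (TrivSqZeroExt.inlHom R R).map_det A
  simp only [RingHom.mapMatrix_apply] at h1 h2
  rw [← h1, ← h2]
  simp

theorem detDeriv_eq_trace (A X : Matrix ι ι R) : A.detDeriv X = (A.adjugate * X).trace := by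
  suffices A.detDerivₗ = traceLinearMap ι R R ∘ₗ LinearMap.mulLeft R A.adjugate from
    LinearMap.congr_fun this X
  refine Matrix.ext_linearMap _ fun i j => ?_
  ext
  simp only [LinearMap.comp_apply, singleLinearMap_apply, detDerivₗ, LinearMap.coe_mk,
    AddHom.coe_mk, detDeriv_single, traceLinearMap_apply, LinearMap.mulLeft_apply]
  rw [trace_mul_comm, trace_single_mul]
  simp

theorem mul_adjDeriv (A X : Matrix ι ι R) :
    A * A.adjDeriv X = (A.adjugate * X).trace • 1 - X * A.adjugate := by
  have h := mul_adjugate (A.deform X)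
  rw [adjugate_deform, deform_mul_deform, det_deform, detDeriv_eq_trace] at h
  rw [eq_sub_iff_add_eq]
  ext i j
  have := congrArg TrivSqZeroExt.snd (congrFun (congrFun h i) j)
  by_cases hij : i = j <;> simpa [deform, hij, one_apply] using this

theorem adjDeriv_mul (A X : Matrix ι ι R) :
    A.adjDeriv X * A = (A.adjugate * X).trace • 1 - A.adjugate * X := by
  have h := adjugate_mul (A.deform X)
  rw [adjugate_deform, deform_mul_deform, det_deform, detDeriv_eq_trace] at h
  rw [eq_sub_iff_add_eq']
  ext i j
  have := congrArg TrivSqZeroExt.snd (congrFun (congrFun h i) j)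
  by_cases hij : i = j <;> simpa [deform, hij, one_apply] using this

theorem adjDeriv_one (X : Matrix ι ι R) : (1 : Matrix ι ι R).adjDeriv X = X.trace • 1 - X := by
  simpa using adjDeriv_mul 1 X

theorem adjDeriv_zero (A : Matrix ι ι R) : A.adjDeriv (0 : Matrix ι ι R) = 0 :=
  map_zero A.adjDerivₗ

theorem adjDeriv_mul_self (A U : Matrix ι ι R) :
    A.adjDeriv (U * A) = U.trace • A.adjugate - A.adjugate * U := by
  have h : A.deform (U * A) = (1 : Matrix ι ι R).deform U * A.deform 0 := by
    rw [deform_mul_deform]; simp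
  rw [adjDeriv, h, adjugate_mul_distrib, adjugate_deform, adjugate_deform, deform_mul_deform,
    deform_map_snd, adjDeriv_one, adjDeriv_zero]
  simp [mul_sub]

theorem adjDeriv_self_mul (A W : Matrix ι ι R) :
    A.adjDeriv (A * W) = W.trace • A.adjugate - W * A.adjugate := by
  have h : A.deform (A * W) = A.deform 0 * (1 : Matrix ι ι R).deform W := by
    rw [deform_mul_deform]; simp
  rw [adjDeriv, h, adjugate_mul_distrib, adjugate_deform, adjugate_deform, deform_mul_deform,
    deform_map_snd, adjDeriv_one, adjDeriv_zero]
  simp [sub_mul]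

theorem adjDeriv_single_apply (A : Matrix ι ι R) (k l i j : ι) :
    A.adjDeriv (single k l (1 : R)) j i = if k = i then 0 else
      ((A.updateRow i (Pi.single j 1)).updateRow k (Pi.single l 1)).det := by
  have hsnd : A.adjDeriv (single k l (1 : R)) j i =
      ((A.deform (single k l (1 : R))).updateRow i (Pi.single j 1)).det.snd := by
    rw [adjDeriv, map_apply, adjugate_apply]
  rw [hsnd]
  split_ifs with h
  · have : (A.deform (single k l (1 : R))).updateRow i (Pi.single j 1) =
        (A.updateRow i (Pi.single j 1)).deform (0 : Matrix ι ι R) := by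
      subst h
      ext a b <;> by_cases ha : a = k <;> by_cases hb : b = j <;>
        simp [deform, updateRow_apply, single_apply, eq_comm (a := k) (b := a), ha, hb]
    rw [this]
    exact map_zero (detDerivₗ _)
  · have : (A.deform (single k l (1 : R))).updateRow i (Pi.single j 1) =
        (A.updateRow i (Pi.single j 1)).deform (single k l (1 : R)) := by
      ext a b <;> by_cases ha : a = i <;> by_cases hb : b = j <;>
        simp [deform, updateRow_apply, single_apply, ha, hb, h]
    rw [this, ← adjugate_apply, ← detDeriv_single]
    rfl

theorem trace_mul_adjDeriv_single (A X : Matrix ι ι R) (i j : ι) :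
    (X * A.adjDeriv (single i j (1 : R))).trace = (A.adjDeriv X * single i j 1).trace := by
  suffices traceLinearMap ι R R ∘ₗ LinearMap.mulRight R (A.adjDeriv (single i j (1 : R))) =
      traceLinearMap ι R R ∘ₗ LinearMap.mulRight R (single i j (1 : R)) ∘ₗ A.adjDerivₗ from
    LinearMap.congr_fun this X
  refine Matrix.ext_linearMap _ fun k l => ?_
  ext
  simp only [LinearMap.comp_apply, singleLinearMap_apply, adjDerivₗ, LinearMap.coe_mk,
    AddHom.coe_mk, traceLinearMap_apply, LinearMap.mulRight_apply]
  rw [trace_single_mul, trace_mul_comm, trace_single_mul, adjDeriv_single_apply,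
    adjDeriv_single_apply]
  by_cases h : i = k
  · simp [h]
  · rw [if_neg h, if_neg (Ne.symm h), updateRow_comm _ h]

end Matrix
end

section
open Matrix

variable {R : Type*} [CommRing R] {ι : Type*} [Fintype ι] [DecidableEq ι]

namespace GulliksenNegard

variable (R) in
/-- The middle term of the Gulliksen–Negård complex: the homology of
`R → M × M → R`, `c ↦ (c, c)`, `(U, W) ↦ tr U - tr W`, realised inside the kernel of the second map
by normalising the `(o, o)` entry of `U` to be zero. -/
def mid (o : ι) : Submodule R (Matrix ι ι R × Matrix ι ι R) where
  carrier := {p | p.1.trace = p.2.trace ∧ p.1 o o = 0}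
  add_mem' {p q} hp hq := by
    simp only [Set.mem_ofPred_eq] at hp hq ⊢
    simp [hp, hq]
  zero_mem' := by simp
  smul_mem' c p hp := by
    simp only [Set.mem_ofPred_eq] at hp ⊢
    simp [hp]

theorem mem_mid {o : ι} {p : Matrix ι ι R × Matrix ι ι R} :
    p ∈ mid R o ↔ p.1.trace = p.2.trace ∧ p.1 o o = 0 := Iff.rfl

variable (R) in
/-- The retraction of `M × M` onto the middle term of the complex. -/
def proj (o : ι) : Matrix ι ι R × Matrix ι ι R →ₗ[R] mid R o where
  toFun p := ⟨(p.1 - p.1 o o • 1,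
    p.2 + (p.1.trace - p.2.trace) • single o o 1 - p.1 o o • 1), by simp [mem_mid]⟩
  map_add' p q := by
    ext1
    simp only [Submodule.coe_add, Prod.mk_add_mk, Prod.fst_add, Prod.snd_add, trace_add,
      Matrix.add_apply, Prod.mk.injEq]
    constructor <;> module
  map_smul' c p := by
    ext1
    simp only [Submodule.coe_smul, Prod.smul_mk, Prod.smul_fst, Prod.smul_snd, trace_smul,
      Matrix.smul_apply, Prod.mk.injEq, smul_eq_mul, RingHom.id_apply]
    constructor <;> module

theorem proj_coe (o : ι) (p : mid R o) : proj R o p = p := by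
  obtain ⟨p, hp⟩ := p
  rw [mem_mid] at hp
  ext1
  simp [proj, hp.1, hp.2]

theorem proj_smul_one (o : ι) (c : R) : proj R o (c • 1, c • 1) = 0 := by
  ext1
  simp [proj]

instance projective_mid (o : ι) : Module.Projective R (mid R o) :=
  Module.Projective.of_split (mid R o).subtype (proj R o) (LinearMap.ext (proj_coe o))

variable (A : Matrix ι ι R) (o : ι)

/-- The differential from degree 1 to degree 0. -/
def d₁ : Matrix ι ι R →ₗ[R] R := traceLinearMap ι R R ∘ₗ LinearMap.mulLeft R A.adjugate

/-- The differential from degree 2 to degree 1, before restriction to the middle term. -/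
def commutator : Matrix ι ι R × Matrix ι ι R →ₗ[R] Matrix ι ι R :=
  LinearMap.mulRight R A ∘ₗ LinearMap.fst R _ _ - LinearMap.mulLeft R A ∘ₗ LinearMap.snd R _ _

/-- The differential from degree 2 to degree 1. -/
def d₂ : mid R o →ₗ[R] Matrix ι ι R := commutator A ∘ₗ (mid R o).subtype

/-- The differential from degree 3 to degree 2. -/
def d₃ : Matrix ι ι R →ₗ[R] mid R o :=
  proj R o ∘ₗ (LinearMap.mulLeft R A).prod (LinearMap.mulRight R A)

/-- The differential from degree 4 to degree 3. -/
def d₄ : R →ₗ[R] Matrix ι ι R := LinearMap.toSpanSingleton R _ A.adjugate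

theorem d₁_apply (N : Matrix ι ι R) : d₁ A N = (A.adjugate * N).trace := rfl

theorem d₂_apply (p : mid R o) : d₂ A o p = p.1.1 * A - A * p.1.2 := rfl

theorem d₃_apply (V : Matrix ι ι R) : d₃ A o V = proj R o (A * V, V * A) := rfl

theorem d₄_apply (x : R) : d₄ A x = x • A.adjugate := rfl

theorem d₂_proj (p : Matrix ι ι R × Matrix ι ι R) (hp : p.1.trace = p.2.trace) :
    d₂ A o (proj R o p) = p.1 * A - A * p.2 := by
  simp [d₂_apply, proj, hp, sub_mul, mul_sub]

theorem d₁_d₂ (p : mid R o) : d₁ A (d₂ A o p) = 0 := by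
  have h := (mem_mid.1 p.2).1
  rw [d₁_apply, d₂_apply, mul_sub, trace_sub, ← Matrix.mul_assoc, ← Matrix.mul_assoc,
    trace_mul_cycle, mul_adjugate, adjugate_mul]
  simp [h]

theorem d₂_d₃ (V : Matrix ι ι R) : d₂ A o (d₃ A o V) = 0 := by
  rw [d₃_apply, d₂_proj _ _ _ (trace_mul_comm A V), Matrix.mul_assoc, sub_self]

theorem d₃_d₄ (x : R) : d₃ A o (d₄ A x) = 0 := by
  rw [d₄_apply, map_smul, d₃_apply, mul_adjugate, adjugate_mul, proj_smul_one, smul_zero]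

theorem adjugate_smul_mem_range_d₂ (i j : ι) (N : Matrix ι ι R) (hN : d₁ A N = 0) :
    A.adjugate j i • N ∈ LinearMap.range (d₂ A o) := by
  refine ⟨proj R o (N * A.adjDeriv (single i j 1), A.adjDeriv N * single i j 1), ?_⟩
  rw [d₁_apply] at hN
  rw [d₂_proj _ _ _ (trace_mul_adjDeriv_single _ _ _ _), Matrix.mul_assoc, adjDeriv_mul,
    ← Matrix.mul_assoc, mul_adjDeriv, hN, trace_mul_comm, trace_single_mul]
  simp [mul_sub, Matrix.mul_assoc]

theorem adjugate_smul_mem_range_d₃ (i j : ι) (p : mid R o) (hp : d₂ A o p = 0) :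
    A.adjugate j i • p ∈ LinearMap.range (d₃ A o) := by
  obtain ⟨⟨U, W⟩, h⟩ := p
  have htr : U.trace = W.trace := h.1
  have hUW : U * A = A * W := sub_eq_zero.1 hp
  have hadj : A.adjugate * U = W * A.adjugate := by
    have := adjDeriv_mul_self A U
    rw [hUW, adjDeriv_self_mul, htr] at this
    exact (sub_right_injective this).symm
  set E : Matrix ι ι R := single i j 1
  have htrE : (A.adjugate * E).trace = A.adjugate j i := by
    rw [trace_mul_comm, trace_single_mul, one_smul]
  set τ := (A.adjugate * (U * E)).trace
  let S := W * A.adjDeriv E - A.adjDeriv (U * E)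
  have h1 : A * S = A.adjugate j i • U - τ • 1 := by
    rw [mul_sub, ← Matrix.mul_assoc, ← hUW, Matrix.mul_assoc, mul_adjDeriv, mul_adjDeriv, htrE,
      mul_sub, Matrix.mul_smul, Matrix.mul_one, Matrix.mul_assoc]
    abel
  have h2 : S * A = A.adjugate j i • W - τ • 1 := by
    have h' : A.adjugate * (U * E) = W * A.adjugate * E := by rw [← Matrix.mul_assoc, hadj]
    rw [sub_mul, Matrix.mul_assoc, adjDeriv_mul, adjDeriv_mul, htrE, mul_sub, Matrix.mul_smul,
      Matrix.mul_one, ← Matrix.mul_assoc W, ← h']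
    abel
  refine ⟨S, ?_⟩
  have h3 : (A * S, S * A) = A.adjugate j i • (U, W) - (τ • 1, τ • 1) := by
    rw [h1, h2]; rfl
  rw [d₃_apply, h3, map_sub, proj_smul_one, sub_zero, map_smul]
  exact congrArg _ (proj_coe o ⟨(U, W), h⟩)

theorem adjugate_smul_mem_range_d₄ (i j : ι) (V : Matrix ι ι R) (hV : d₃ A o V = 0) :
    A.adjugate j i • V ∈ LinearMap.range (d₄ A) := by
  rw [d₃_apply] at hV
  have hV1 : A * V - (A * V) o o • 1 = 0 := congrArg (fun p => p.1.1) hV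
  have hV2 : V * A + ((A * V).trace - (V * A).trace) • single o o 1 - (A * V) o o • 1 = 0 :=
    congrArg (fun p => p.1.2) hV
  rw [trace_mul_comm, sub_self, zero_smul, add_zero, sub_eq_zero] at hV2
  rw [sub_eq_zero] at hV1
  set c := (A * V) o o
  set E : Matrix ι ι R := single i j 1
  refine ⟨(V * E).trace, ?_⟩
  have h1 : c • A.adjDeriv E = (V * E).trace • A.adjugate - V * E * A.adjugate := by
    rw [← adjDeriv_self_mul, ← Matrix.mul_assoc, hV1, Matrix.smul_mul, Matrix.one_mul,
      adjDeriv_smul]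
  have h2 : c • A.adjDeriv E = A.adjugate j i • V - V * E * A.adjugate := by
    rw [← Matrix.one_mul (A.adjDeriv E), ← Matrix.smul_mul, ← hV2, Matrix.mul_assoc, mul_adjDeriv,
      trace_mul_comm, trace_single_mul, mul_sub, Matrix.mul_smul, Matrix.mul_one, one_smul,
      Matrix.mul_assoc]
  rw [d₄_apply]
  exact sub_left_injective (h1.symm.trans h2)

theorem adjugate_smul_eq_zero (i j : ι) (x : R) (hx : d₄ A x = 0) : A.adjugate j i • x = 0 := by
  simpa [d₄_apply, mul_comm] using congrFun (congrFun hx j) i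

theorem range_d₁ : LinearMap.range (d₁ A) =
    Ideal.span (Set.range fun p : ι × ι => A.adjugate p.1 p.2) := by
  apply le_antisymm
  · rintro _ ⟨N, rfl⟩
    rw [d₁_apply, trace]
    refine sum_mem fun i _ => ?_
    rw [diag_apply, mul_apply]
    exact sum_mem fun j _ => Ideal.mul_mem_right _ _ (Ideal.subset_span ⟨(i, j), rfl⟩)
  · rw [Ideal.span_le]
    rintro _ ⟨⟨i, j⟩, rfl⟩
    refine ⟨single j i 1, ?_⟩
    rw [d₁_apply, trace_mul_comm, trace_single_mul, one_smul]

end GulliksenNegard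
end

section
open Limits

universe u

variable {R : Type u} [CommRing R] {X : ℕ → ModuleCat.{u} R} (d : ∀ i, X (i + 1) ⟶ X i)
  (hdd : ∀ i x, d i (d (i + 1) x) = 0)

/-- The chain complex of modules with given terms and differentials. -/
noncomputable def chainComplexOfModules : ChainComplex (ModuleCat.{u} R) ℕ :=
  ChainComplex.of X d fun i => by ext x; exact hdd i x

theorem chainComplexOfModules_d (i : ℕ) : (chainComplexOfModules d hdd).d (i + 1) i = d i :=
  ChainComplex.of_d X d i

/-- The projective resolution given by an exact sequence of projective modules. -/
noncomputable def CategoryTheory.ProjectiveResolution.ofExact [∀ i, Module.Projective R (X i)]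
    (hex : ∀ i x, d i x = 0 → x ∈ LinearMap.range (d (i + 1)).hom) {N : ModuleCat.{u} R}
    (p : X 0 ⟶ N) (hp : Function.Surjective p)
    (hker : ∀ x, p x = 0 ↔ x ∈ LinearMap.range (d 0).hom) :
    ProjectiveResolution N where
  complex := chainComplexOfModules d hdd
  projective i := (IsProjective.iff_projective (X i)).1 inferInstance
  π := (ChainComplex.toSingle₀Equiv _ _).symm ⟨p, by
    rw [chainComplexOfModules_d]
    ext x
    exact (hker _).2 ⟨x, rfl⟩⟩
  quasiIso := ⟨fun n => by
    cases n with
    | zero =>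
      rw [ChainComplex.quasiIsoAt₀_iff, ShortComplex.quasiIso_iff_of_zeros' _ rfl rfl rfl]
      constructor
      · rw [ShortComplex.moduleCat_exact_iff]
        intro x hx
        obtain ⟨y, rfl⟩ := (hker x).1 (.trans (congrArg (fun f => f.hom x)
          (ChainComplex.toSingle₀Equiv_symm_apply_f_zero (C := chainComplexOfModules d hdd)
            p _).symm) hx)
        exact ⟨y, congrArg (fun f => f.hom y) (chainComplexOfModules_d d hdd 0)⟩
      · rw [ModuleCat.epi_iff_surjective]
        intro x
        obtain ⟨y, rfl⟩ := hp x
        exact ⟨y, congrArg (fun f => f.hom y)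
          (ChainComplex.toSingle₀Equiv_symm_apply_f_zero (C := chainComplexOfModules d hdd) p _)⟩
    | succ n =>
      rw [quasiIsoAt_iff_exactAt' (hL := ChainComplex.exactAt_succ_single_obj ..),
        HomologicalComplex.exactAt_iff' _ (n + 2) (n + 1) n (by simp) (by simp),
        ShortComplex.moduleCat_exact_iff]
      intro x hx
      obtain ⟨y, rfl⟩ := hex n x
        (.trans (congrArg (fun f => f.hom x) (chainComplexOfModules_d d hdd n).symm) hx)
      exact ⟨y, congrArg (fun f => f.hom y) (chainComplexOfModules_d d hdd (n + 1))⟩⟩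

theorem CategoryTheory.ProjectiveResolution.isZero_Ext {N : ModuleCat.{u} R}
    (P : ProjectiveResolution N)
    (Y : ModuleCat.{u} R) (i : ℕ) (h : IsZero (P.complex.X i)) :
    IsZero (((Ext R (ModuleCat.{u} R) i).obj (Opposite.op N)).obj Y) := by
  refine IsZero.of_iso ?_ (P.isoExt i Y)
  rw [← HomologicalComplex.exactAt_iff_isZero_homology, HomologicalComplex.exactAt_iff]
  refine ShortComplex.exact_of_isZero_X₂ _ ?_
  rw [IsZero.iff_id_eq_zero]
  ext (x : _ ⟶ _)
  obtain rfl : x = 0 := h.eq_of_src _ _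
  rfl

/-- If a projective resolution vanishes in degree `i + 2`, then `Ext^(i+1)` into `Y` is any module
`Q` that is the cokernel of precomposition with `d (i + 2) (i + 1)`. -/
noncomputable def CategoryTheory.ProjectiveResolution.extIso {N : ModuleCat.{u} R}
    (P : ProjectiveResolution N)
    (Y : ModuleCat.{u} R) (i : ℕ) (h : IsZero (P.complex.X (i + 2))) (Q : ModuleCat.{u} R)
    (q : (P.complex.X (i + 1) ⟶ Y) →ₗ[R] Q) (hq : Function.Surjective q)
    (hker : ∀ f, q f = 0 ↔ ∃ g, P.complex.d (i + 1) i ≫ g = f) :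
    ((Ext R (ModuleCat.{u} R) (i + 1)).obj (Opposite.op N)).obj Y ≅ Q := by
  let K := P.complex.linearYonedaObj R Y
  let S := K.sc' i (i + 1) (i + 2)
  have hg : S.g = 0 := by
    ext x
    exact h.eq_of_src _ _
  let q' : S.X₂ →ₗ[R] Q := q
  have hq' : LinearMap.range S.f.hom = LinearMap.ker q' := by
    ext f
    exact (hker f).symm
  exact P.isoExt (i + 1) Y ≪≫
    ShortComplex.homologyMapIso (K.isoSc' i (i + 1) (i + 2) (by simp) (by simp)) ≪≫
    S.asIsoHomologyι hg ≪≫ S.moduleCatOpcyclesIso ≪≫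
    ((Submodule.quotEquivOfEq _ _ hq').trans (q'.quotKerEquivOfSurjective hq)).toModuleIso
end

theorem RingTheory.Sequence.IsWeaklyRegular.of_flat_module {R M : Type*} [CommRing R]
    [AddCommGroup M]
    [Module R M] [Module.Flat R M] {rs : List R} (h : IsWeaklyRegular R rs) :
    IsWeaklyRegular M rs :=
  (LinearEquiv.isWeaklyRegular_congr (TensorProduct.rid R M) rs).1
    (h.isWeaklyRegular_lTensor (M₂ := M))

namespace GulliksenNegard
open RingTheory.Sequence

universe u

variable {R : Type u} [CommRing R] {ι : Type} [Fintype ι] [DecidableEq ι] (A : Matrix ι ι R) (o : ι)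

variable (R) in
/-- The terms of the Gulliksen–Negård complex. -/
def term (o : ι) : ℕ → ModuleCat.{u} R
  | 0 => .of R R
  | 1 => .of R (Matrix ι ι R)
  | 2 => .of R (mid R o)
  | 3 => .of R (Matrix ι ι R)
  | 4 => .of R R
  | _ + 5 => .of R PUnit.{u + 1}

/-- The differentials of the Gulliksen–Negård complex. -/
def diff : ∀ i, term R o (i + 1) ⟶ term R o i
  | 0 => ModuleCat.ofHom (d₁ A)
  | 1 => ModuleCat.ofHom (d₂ A o)
  | 2 => ModuleCat.ofHom (d₃ A o)
  | 3 => ModuleCat.ofHom (d₄ A)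
  | _ + 4 => 0

instance projective_term : ∀ i, Module.Projective R (term R o i)
  | 0 => inferInstanceAs (Module.Projective R R)
  | 1 => inferInstanceAs (Module.Projective R (Matrix ι ι R))
  | 2 => inferInstanceAs (Module.Projective R (mid R o))
  | 3 => inferInstanceAs (Module.Projective R (Matrix ι ι R))
  | 4 => inferInstanceAs (Module.Projective R R)
  | _ + 5 => inferInstanceAs (Module.Projective R PUnit.{u + 1})

theorem subsingleton_term (i : ℕ) : Subsingleton (term R o (i + 5)) :=
  inferInstanceAs (Subsingleton PUnit.{u + 1})

theorem diff_diff : ∀ i x, diff A o i (diff A o (i + 1) x) = 0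
  | 0 => d₁_d₂ A o
  | 1 => d₂_d₃ A o
  | 2 => d₃_d₄ A o
  | 3 => fun _ => map_zero _
  | _ + 4 => fun _ => rfl

theorem adjugate_smul_mem_range_diff (i j : ι) : ∀ n x, diff A o n x = 0 →
    A.adjugate j i • x ∈ LinearMap.range (diff A o (n + 1)).hom
  | 0 => adjugate_smul_mem_range_d₂ A o i j
  | 1 => adjugate_smul_mem_range_d₃ A o i j
  | 2 => adjugate_smul_mem_range_d₄ A o i j
  | 3 => fun x hx => by
    rw [show A.adjugate j i • x = 0 from adjugate_smul_eq_zero A i j x hx]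
    exact zero_mem _
  | n + 4 => fun x _ => by
    rw [(subsingleton_term o n).elim (A.adjugate j i • x) 0]
    exact zero_mem _

theorem smul_mem_range_diff {r : R} (hr : r ∈ LinearMap.range (d₁ A)) (n : ℕ)
    (x : term R o (n + 1)) (hx : diff A o n x = 0) :
    r • x ∈ LinearMap.range (diff A o (n + 1)).hom := by
  rw [range_d₁] at hr
  induction hr using Submodule.span_induction with
  | mem r hr =>
    obtain ⟨⟨j, i⟩, rfl⟩ := hr
    exact adjugate_smul_mem_range_diff A o i j n x hx
  | zero =>
    rw [zero_smul]
    exact zero_mem _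
  | add r s _ _ hr hs =>
    rw [add_smul]
    exact add_mem hr hs
  | smul c r _ hr =>
    rw [smul_assoc]
    exact Submodule.smul_mem _ c hr

theorem exact_diff {rs : List R} (hlen : rs.length = 4) (hrs : ∀ r ∈ rs, r ∈ LinearMap.range (d₁ A))
    (hreg : IsWeaklyRegular R rs) (n : ℕ) (x : term R o (n + 1)) (hx : diff A o n x = 0) :
    x ∈ LinearMap.range (diff A o (n + 1)).hom :=
  acyclic_of_isWeaklyRegular rs (fun i => term R o i) (fun i => (diff A o i).hom) (diff_diff A o)
    (fun i hi => by
      obtain ⟨i, rfl⟩ := Nat.exists_eq_add_of_le' (show 5 ≤ i by lia)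
      exact subsingleton_term o i)
    (fun i => hreg.of_flat_module)
    (fun r hr n x hx => ⟨1, by
      rw [pow_one]
      exact smul_mem_range_diff A o (hrs r hr) n x hx⟩) n x hx

/-- The resolution of `R / I` by the Gulliksen–Negård complex, where `I` is the ideal of submaximal
minors. -/
noncomputable def resolution {rs : List R} (hlen : rs.length = 4) {I : Ideal R}
    (hI : I = LinearMap.range (d₁ A)) (hrs : ∀ r ∈ rs, r ∈ I) (hreg : IsWeaklyRegular R rs) :
    ProjectiveResolution (ModuleCat.of R (R ⧸ I)) :=
  ProjectiveResolution.ofExact (diff A o) (diff_diff A o)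
    (exact_diff A o hlen (fun r hr => hI ▸ hrs r hr) hreg)
    (ModuleCat.ofHom (Submodule.mkQ I)) (Submodule.mkQ_surjective I) (fun x => by
      refine (Submodule.Quotient.mk_eq_zero I).trans ?_
      rw [hI]
      rfl)

theorem apply_adjugate_mem (g : Matrix ι ι R →ₗ[R] R) : g A.adjugate ∈ LinearMap.range (d₁ A) := by
  rw [Matrix.matrix_eq_sum_single A.adjugate]
  simp only [map_sum]
  refine sum_mem fun i _ => sum_mem fun j _ => ?_
  rw [← mul_one (A.adjugate i j), ← smul_eq_mul, ← Matrix.smul_single, map_smul, smul_eq_mul,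
    range_d₁]
  exact Ideal.mul_mem_right _ _ (Ideal.subset_span ⟨(i, j), rfl⟩)

/-- Evaluation at `1`, modulo `I`. -/
noncomputable def evalOne (I : Ideal R) :
    (ModuleCat.of R R ⟶ ModuleCat.of R R) →ₗ[R] R ⧸ I where
  toFun f := Submodule.mkQ I (f.hom 1)
  map_add' _ _ := rfl
  map_smul' _ _ := rfl

theorem isGorensteinQuotient {R : Type} [CommRing R] (A : Matrix ι ι R) (o : ι)
    {rs : List R} (hlen : rs.length = 4) {I : Ideal R}
    (hI : I = LinearMap.range (d₁ A)) (hrs : ∀ r ∈ rs, r ∈ I) (hreg : IsWeaklyRegular R rs) :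
    IsGorensteinQuotient I 4 := by
  let P := resolution A o hlen hI hrs hreg
  have hP i : Limits.IsZero (P.complex.X (i + 5)) :=
    @ModuleCat.isZero_of_subsingleton _ _ (term R o (i + 5)) (subsingleton_term o i)
  constructor
  · refine ⟨P.extIso _ 3 (hP 0) (.of R (R ⧸ I)) (evalOne I) (fun x => ?_) (fun f => ?_)⟩
    · obtain ⟨x, rfl⟩ := Submodule.mkQ_surjective I x
      exact ⟨ModuleCat.ofHom (LinearMap.toSpanSingleton R R x), congrArg _ (one_smul R x)⟩
    · have hd : P.complex.d (3 + 1) 3 = ModuleCat.ofHom (d₄ A) :=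
        chainComplexOfModules_d (diff A o) (diff_diff A o) 3
      rw [hd]
      refine (Submodule.Quotient.mk_eq_zero I).trans ((SetLike.ext_iff.1 hI _).trans ?_)
      constructor
      · rintro ⟨N, hN⟩
        refine ⟨ModuleCat.ofHom (Matrix.traceLinearMap ι R R ∘ₗ LinearMap.mulRight R N), ?_⟩
        refine ModuleCat.hom_ext (LinearMap.ext_ring (.trans ?_ hN))
        exact congrArg (fun M => (M * N).trace) (one_smul R A.adjugate)
      · rintro ⟨g, rfl⟩
        have := apply_adjugate_mem A g.hom
        rwa [← one_smul R A.adjugate] at this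
  · intro i hi
    obtain ⟨i, rfl⟩ := Nat.exists_eq_add_of_le' (show 5 ≤ i by lia)
    exact P.isZero_Ext _ _ (hP i)

end GulliksenNegard

theorem idealCodim_eq_height {R : Type*} [CommRing R] (I : Ideal R) : idealCodim I = I.height := by
  rw [Ideal.height_eq_inf_minimalPrimes, idealCodim]
  apply le_antisymm
  · refine le_iInf₂ fun p hp => ?_
    exact (iInf₂_le (⟨p, hp.1.1⟩ : PrimeSpectrum R) hp).trans_eq
      (PrimeSpectrum.height_eq_orderHeight ⟨p, hp.1.1⟩).symm
  · refine le_iInf₂ fun p hp => ?_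
    exact (iInf₂_le p.asIdeal hp).trans_eq (PrimeSpectrum.height_eq_orderHeight p)

theorem GulliksenNegard.span_minors_eq_range {R : Type*} [CommRing R] {t : ℕ}
    (A : Matrix (Fin (t + 1)) (Fin (t + 1)) R) :
    Ideal.span {d | ∃ r c : Fin (t + 1), d = (A.submatrix r.succAbove c.succAbove).det} =
      LinearMap.range (d₁ A) := by
  rw [range_d₁]
  apply le_antisymm <;> rw [Ideal.span_le]
  · rintro _ ⟨r, c, rfl⟩
    have h : (A.submatrix r.succAbove c.succAbove).det =
        (-1) ^ (r + c : ℕ) * A.adjugate c r := by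
      rw [Matrix.adjugate_fin_succ_eq_det_submatrix, ← mul_assoc, ← mul_pow]
      simp
    rw [h]
    exact Ideal.mul_mem_left _ _ (Ideal.subset_span ⟨(c, r), rfl⟩)
  · rintro _ ⟨⟨c, r⟩, rfl⟩
    dsimp only
    rw [Matrix.adjugate_fin_succ_eq_det_submatrix]
    exact Ideal.mul_mem_left _ _ (Ideal.subset_span ⟨r, c, rfl⟩)

/-- Gulliksen–Negård: over a field of characteristic 0, if
`A = R/I_{t-1}(𝒜)` where `𝒜` is a `(t+1) × (t+1)` homogeneous matrix and the
ideal of submaximal minors `I_{t-1}(𝒜)` has codimension 4, then `A` is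
Gorenstein, i.e. `X = Proj A ⊂ Pⁿ` is arithmetically Gorenstein. -/
theorem stmt10 (k : Type) [Field k] [CharZero k] (n t : ℕ)
    (a b : Fin (t + 1) → ℤ)
    (A : Matrix (Fin (t + 1)) (Fin (t + 1)) (MvPolynomial (Fin (n + 1)) k))
    (hA : ∀ j i, IsHomogZ (A j i) (a j - b i))
    (I : Ideal (MvPolynomial (Fin (n + 1)) k))
    (hI : I = Ideal.span
      {d | ∃ r c : Fin (t + 1), d = (A.submatrix r.succAbove c.succAbove).det})
    (hcodim : idealCodim I = 4) :
    IsGorensteinQuotient I 4 := by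
  rw [idealCodim_eq_height] at hcodim
  have hne : I ≠ ⊤ := by
    rintro rfl
    simp at hcodim
  obtain ⟨rs, hlen, hrs, hreg⟩ :=
    hasRegularSequences_mvPolynomial k (n + 1) I 4 hne hcodim.ge
  exact GulliksenNegard.isGorensteinQuotient A 0 hlen
    (hI.trans (GulliksenNegard.span_minors_eq_range A)) hrs hreg
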